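/- arXiv:1904.01211 — 2 statements merged into one kernel-verified Lean document; each statement's English description precedes it below -/
import Mathlib

section
/- Let f = e^{-ψ} be a nondegenerate integrable log-concave function on ℝⁿ. Then the map s ↦ ξ_f(s) = s · max{ det T : T ∈ S₊, T B₂ⁿ ⊆ G_f(s) } is continuous on (0, ‖f‖_∞]. -/
open MeasureTheory Metric Set

noncomputable section

abbrev En (n : ℕ) := EuclideanSpace ℝ (Fin n)

def LogConcaveFn {n : ℕ} (f : En n → ℝ) : Prop :=
  (∀ x, 0 ≤ f x) ∧
  ∀ x y : En n, ∀ l : ℝ, 0 ≤ l → l ≤ 1 →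
    f x ^ l * f y ^ (1 - l) ≤ f (l • x + (1 - l) • y)

/-- `ξ_f(s) = s · max{ det T : T ∈ S₊, T B₂ⁿ ⊆ G_f(s) }`. -/
def xiFn {n : ℕ} (f : En n → ℝ) (s : ℝ) : ℝ :=
  s * sSup {d : ℝ | ∃ T : Matrix (Fin n) (Fin n) ℝ, T.PosDef ∧
    Matrix.toEuclideanLin T '' closedBall (0 : En n) 1 ⊆ {x | s ≤ f x} ∧ d = T.det}

/-- The determinants of the positive definite matrices mapping the unit ball into `G_f(s)`. -/
def inscribedDets {n : ℕ} (f : En n → ℝ) (s : ℝ) : Set ℝ :=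
  {d : ℝ | ∃ T : Matrix (Fin n) (Fin n) ℝ, T.PosDef ∧
    Matrix.toEuclideanLin T '' closedBall (0 : En n) 1 ⊆ {x | s ≤ f x} ∧ d = T.det}

lemma LogConcaveFn.convex_superlevel {n : ℕ} {f : En n → ℝ} (hlc : LogConcaveFn f)
    {s : ℝ} (hs : 0 < s) : Convex ℝ {x | s ≤ f x} := by
  intro x hx y hy a b ha hb hab
  obtain rfl : b = 1 - a := by linarith
  have h := hlc.2 x y a ha (by linarith)
  have h1 : s ^ a ≤ f x ^ a := Real.rpow_le_rpow hs.le hx ha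
  have h2 : s ^ (1 - a) ≤ f y ^ (1 - a) := Real.rpow_le_rpow hs.le hy hb
  have h3 : s ^ a * s ^ (1 - a) = s := by
    rw [← Real.rpow_add hs]; simp
  have h4 : 0 ≤ f x ^ a := Real.rpow_nonneg (hlc.1 x) a
  calc s = s ^ a * s ^ (1 - a) := h3.symm
    _ ≤ f x ^ a * f y ^ (1 - a) := by gcongr
    _ ≤ _ := h

lemma measure_superlevel_lt_top {n : ℕ} {f : En n → ℝ} (hint : Integrable f)
    {s : ℝ} (hs : 0 < s) : volume {x | s ≤ f x} < ⊤ := by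
  refine (measure_mono ?_).trans_lt (hint.measure_norm_ge_lt_top hs)
  exact fun x (hx : s ≤ f x) => hx.trans (le_abs_self _)

lemma det_toEuclideanLin {n : ℕ} (T : Matrix (Fin n) (Fin n) ℝ) :
    LinearMap.det (Matrix.toEuclideanLin T) = T.det := by
  rw [Matrix.toEuclideanLin, Matrix.toLpLin_eq_toLin, LinearMap.det_toLin]

lemma bddAbove_inscribedDets {n : ℕ} {f : En n → ℝ} (hint : Integrable f)
    {s : ℝ} (hs : 0 < s) : BddAbove (inscribedDets f s) := by
  have hfin := measure_superlevel_lt_top hint hs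
  have hb0 : volume (closedBall (0 : En n) 1) ≠ 0 :=
    (measure_closedBall_pos _ _ one_pos).ne'
  have hb1 : volume (closedBall (0 : En n) 1) ≠ ⊤ := measure_closedBall_lt_top.ne
  refine ⟨(volume {x | s ≤ f x}).toReal / (volume (closedBall (0 : En n) 1)).toReal, ?_⟩
  rintro d ⟨T, hT, hsub, rfl⟩
  have h := measure_mono (μ := volume) hsub
  rw [Measure.addHaar_image_linearMap, det_toEuclideanLin] at h
  rw [le_div_iff₀ (ENNReal.toReal_pos hb0 hb1)]
  have h2 := ENNReal.toReal_mono hfin.ne h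
  rwa [ENNReal.toReal_mul, ENNReal.toReal_ofReal (abs_nonneg _), abs_of_pos hT.det_pos] at h2

/-- A convex set of finite volume containing a neighbourhood of the origin is bounded. -/
lemma exists_norm_le_of_convex_of_measure_lt_top {n : ℕ} {K : Set (En n)} (hK : Convex ℝ K)
    (hfin : volume K < ⊤) {r : ℝ} (hr : 0 < r) (hball : ball 0 r ⊆ K) :
    ∃ R : ℝ, ∀ q ∈ K, ‖q‖ ≤ R := by
  have hb0 : volume (ball (0 : En n) (r / 2)) ≠ 0 :=
    (measure_ball_pos _ _ (half_pos hr)).ne'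
  obtain ⟨N, hN⟩ := ENNReal.exists_nat_mul_gt hb0 hfin.ne
  have hNpos : 0 < N := by
    rcases Nat.eq_zero_or_pos N with rfl | h
    · simp at hN
    · exact h
  have hN' : (0 : ℝ) < N := by exact_mod_cast hNpos
  refine ⟨2 * r * N, fun q hq => ?_⟩
  by_contra! hlt
  let c : ℕ → En n := fun j => ((j : ℝ) / (2 * N)) • q
  have hdisj : (↑(Finset.range N) : Set ℕ).PairwiseDisjoint (fun j => ball (c j) (r / 2)) := by
    intro i _ j _ hij
    refine ball_disjoint_ball ?_
    have h1 : (1 : ℝ) ≤ |(i : ℝ) - j| := by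
      have : (1 : ℤ) ≤ |(i : ℤ) - j| := Int.one_le_abs (by omega)
      exact_mod_cast this
    have h2 : dist (c i) (c j) = |(i : ℝ) - j| * (‖q‖ / (2 * N)) := by
      rw [dist_eq_norm, ← sub_smul, norm_smul, ← sub_div, Real.norm_eq_abs, abs_div,
        abs_of_pos (by positivity : (0 : ℝ) < 2 * N)]
      ring
    have h3 : r ≤ ‖q‖ / (2 * N) := by
      rw [le_div_iff₀ (by positivity)]; linarith
    rw [h2]
    nlinarith
  have hsub : (⋃ j ∈ Finset.range N, ball (c j) (r / 2)) ⊆ K := by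
    intro z hz
    simp only [Set.mem_iUnion] at hz
    obtain ⟨j, hj, hz⟩ := hz
    have hjN : (j : ℝ) ≤ N := by exact_mod_cast (Finset.mem_range.1 hj).le
    have h0 : (0 : En n) ∈ K := hball (mem_ball_self hr)
    have hA : ((j : ℝ) / N) • q ∈ K :=
      hK.smul_mem_of_zero_mem h0 hq ⟨by positivity, (div_le_one hN').2 hjN⟩
    have hB : (2 : ℝ) • (z - c j) ∈ K := by
      apply hball
      rw [mem_ball_zero_iff, norm_smul, ← dist_eq_norm]
      have := mem_ball.1 hz
      norm_num
      linarith
    have := hK hA hB (a := 1 / 2) (b := 1 / 2) (by norm_num) (by norm_num) (by norm_num)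
    convert this using 1
    simp only [c, smul_smul]
    rw [show (1 / 2 : ℝ) * 2 = 1 by norm_num, one_smul,
      show (1 / 2 : ℝ) * (j / N) = j / (2 * N) by field_simp]
    abel
  have hle := measure_mono (μ := volume) hsub
  rw [measure_biUnion_finset hdisj (fun _ _ => measurableSet_ball)] at hle
  simp only [Measure.addHaar_ball_center] at hle
  rw [Finset.sum_const, Finset.card_range, nsmul_eq_mul] at hle
  exact absurd hN (not_lt.2 hle)

lemma toEuclideanLin_inv_apply {n : ℕ} {T : Matrix (Fin n) (Fin n) ℝ} (hT : T.PosDef)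
    (x : En n) : Matrix.toEuclideanLin T (Matrix.toEuclideanLin T⁻¹ x) = x := by
  have hu : IsUnit T.det := hT.det_pos.ne'.isUnit
  simp [Matrix.toLpLin_apply, Matrix.mulVec_mulVec, Matrix.mul_nonsing_inv T hu]

lemma exists_ball_subset_image {n : ℕ} {T : Matrix (Fin n) (Fin n) ℝ} (hT : T.PosDef) :
    ∃ r : ℝ, 0 < r ∧ ball (0 : En n) r ⊆ Matrix.toEuclideanLin T '' closedBall (0 : En n) 1 := by
  have hc : Continuous (Matrix.toEuclideanLin T⁻¹ : En n → En n) :=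
    LinearMap.continuous_of_finiteDimensional _
  have hn : (Matrix.toEuclideanLin T⁻¹ : En n → En n) ⁻¹' closedBall 0 1 ∈ nhds (0 : En n) := by
    apply hc.continuousAt.preimage_mem_nhds
    rw [map_zero]
    exact closedBall_mem_nhds _ one_pos
  obtain ⟨r, hr, hsub⟩ := Metric.mem_nhds_iff.1 hn
  exact ⟨r, hr, fun x hx => ⟨_, hsub hx, toEuclideanLin_inv_apply hT x⟩⟩

/-- If a centred ellipsoid fits into `G_f(s)` and `s` is below the supremum of `f`,
then `f 0` exceeds `s`. -/
lemma lt_apply_zero_of_image_subset {n : ℕ} {f : En n → ℝ} (hlc : LogConcaveFn f)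
    {s : ℝ} (hs : 0 < s) (hsM : s < sSup (range f)) {T : Matrix (Fin n) (Fin n) ℝ}
    (hT : T.PosDef)
    (hsub : Matrix.toEuclideanLin T '' closedBall (0 : En n) 1 ⊆ {x | s ≤ f x}) :
    s < f 0 := by
  obtain ⟨r, hr, hball⟩ := exists_ball_subset_image hT
  have h0 : s ≤ f 0 := hsub (hball (mem_ball_self hr))
  refine lt_of_le_of_ne h0 fun heq => ?_
  obtain ⟨_, ⟨p, rfl⟩, hp⟩ := exists_lt_of_lt_csSup (range_nonempty f) hsM
  set e : ℝ := r / (1 + ‖p‖) / 2 with he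
  have hp1 : 0 < 1 + ‖p‖ := by positivity
  have hepos : 0 < e := by positivity
  have hmem : -(e • p) ∈ ball (0 : En n) r := by
    rw [mem_ball_zero_iff, norm_neg, norm_smul, Real.norm_of_nonneg hepos.le]
    have : e * (1 + ‖p‖) = r / 2 := by rw [he]; field_simp
    nlinarith [norm_nonneg p]
  have hq : s ≤ f (-(e • p)) := hsub (hball hmem)
  set l : ℝ := e / (1 + e) with hl
  have hl0 : 0 < l := by positivity
  have hl1 : 1 - l = 1 / (1 + e) := by rw [hl]; field_simp; ring
  have hl2 : 0 < 1 - l := by rw [hl1]; positivity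
  have h := hlc.2 p (-(e • p)) l hl0.le (by linarith)
  have hz : l • p + (1 - l) • (-(e • p)) = 0 := by
    rw [smul_neg, smul_smul, ← sub_eq_add_neg, ← sub_smul, hl1, hl]
    rw [show e / (1 + e) - 1 / (1 + e) * e = 0 by ring, zero_smul]
  rw [hz, ← heq] at h
  have h1 : s ^ l < f p ^ l := Real.rpow_lt_rpow hs.le hp hl0
  have h2 : s ^ (1 - l) ≤ f (-(e • p)) ^ (1 - l) := Real.rpow_le_rpow hs.le hq hl2.le
  have h3 : s ^ l * s ^ (1 - l) = s := by rw [← Real.rpow_add hs]; simp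
  have h4 : 0 < s ^ (1 - l) := Real.rpow_pos_of_pos hs _
  have h5 : s ^ l * s ^ (1 - l) < f p ^ l * f (-(e • p)) ^ (1 - l) :=
    mul_lt_mul h1 h2 h4 (Real.rpow_nonneg (hlc.1 p) _)
  linarith

lemma inscribedDets_antitone {n : ℕ} (f : En n → ℝ) : Antitone (inscribedDets f) := by
  rintro s t hst d ⟨T, hT, hsub, rfl⟩
  exact ⟨T, hT, fun x hx => hst.trans (hsub hx), rfl⟩

lemma sSup_inscribedDets_nonneg {n : ℕ} (f : En n → ℝ) (s : ℝ) :
    0 ≤ sSup (inscribedDets f s) := by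
  apply Real.sSup_nonneg
  rintro d ⟨T, hT, -, rfl⟩
  exact hT.det_pos.le

lemma sSup_inscribedDets_antitone {n : ℕ} {f : En n → ℝ} (hint : Integrable f) {s t : ℝ}
    (hs : 0 < s) (hst : s ≤ t) : sSup (inscribedDets f t) ≤ sSup (inscribedDets f s) := by
  apply Real.sSup_le _ (sSup_inscribedDets_nonneg f s)
  intro d hd
  exact le_csSup (bddAbove_inscribedDets hint hs) (inscribedDets_antitone f hst hd)

lemma exists_pow_mul_gt {n : ℕ} {c d : ℝ} (h : c < d) :
    ∃ r : ℝ, 0 < r ∧ r < 1 ∧ c < r ^ n * d := by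
  have hc : ContinuousAt (fun r : ℝ => r ^ n * d) 1 := by fun_prop
  have h1 : ∀ᶠ r in nhdsWithin (1 : ℝ) (Iio 1), c < r ^ n * d :=
    (hc.eventually_const_lt (by simpa using h)).filter_mono nhdsWithin_le_nhds
  have h2 : ∀ᶠ r in nhdsWithin (1 : ℝ) (Iio 1), 0 < r :=
    (lt_mem_nhds one_pos).filter_mono nhdsWithin_le_nhds
  obtain ⟨r, ha, hb, hr⟩ := (h1.and (h2.and self_mem_nhdsWithin)).exists
  exact ⟨r, hb, hr, ha⟩

lemma exists_gt_lt_sSup_inscribedDets {n : ℕ} {f : En n → ℝ} (hlc : LogConcaveFn f)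
    (hint : Integrable f) {s c : ℝ} (hs : 0 < s) (hsM : s < sSup (range f))
    (hc : c < sSup (inscribedDets f s)) :
    ∃ t, s < t ∧ c < sSup (inscribedDets f t) := by
  rcases lt_or_ge c 0 with hc0 | hc0
  · exact ⟨s + 1, by linarith, hc0.trans_le (sSup_inscribedDets_nonneg f _)⟩
  have hne : (inscribedDets f s).Nonempty := by
    by_contra hne
    rw [not_nonempty_iff_eq_empty.1 hne, Real.sSup_empty] at hc
    linarith
  obtain ⟨_, ⟨T, hT, hsub, rfl⟩, hcT⟩ := exists_lt_of_lt_csSup hne hc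
  have h0 := lt_apply_zero_of_image_subset hlc hs hsM hT hsub
  obtain ⟨r, hr0, hr1, hr⟩ := exists_pow_mul_gt (n := n) hcT
  have h1r : 0 < 1 - r := by linarith
  have hst : s < s ^ r * f 0 ^ (1 - r) := by
    have h1 : s ^ (1 - r) < f 0 ^ (1 - r) := Real.rpow_lt_rpow hs.le h0 h1r
    have h3 : s ^ r * s ^ (1 - r) = s := by rw [← Real.rpow_add hs]; simp
    have h4 : 0 < s ^ r := Real.rpow_pos_of_pos hs _
    nlinarith
  refine ⟨_, hst, hr.trans_le (le_csSup (bddAbove_inscribedDets hint (hs.trans hst)) ?_)⟩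
  refine ⟨r • T, hT.smul hr0, ?_, by simp⟩
  rintro _ ⟨x, hx, rfl⟩
  have h1 : s ≤ f (Matrix.toEuclideanLin T x) := hsub ⟨x, hx, rfl⟩
  have h2 := hlc.2 (Matrix.toEuclideanLin T x) 0 r hr0.le hr1.le
  rw [smul_zero, add_zero] at h2
  rw [map_smul, LinearMap.smul_apply]
  refine le_trans ?_ h2
  have := Real.rpow_nonneg (hlc.1 0) (1 - r)
  gcongr

lemma mem_pi_Icc_of_norm_toEuclideanLin_le {n : ℕ} {T : Matrix (Fin n) (Fin n) ℝ} {R : ℝ}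
    (h : ∀ x ∈ closedBall (0 : En n) 1, ‖Matrix.toEuclideanLin T x‖ ≤ R) :
    T ∈ Set.pi univ fun _ : Fin n => Set.pi univ fun _ : Fin n => Icc (-R) R := by
  intro i _ j _
  have h1 := h (EuclideanSpace.single j 1) (by simp)
  have h2 := (PiLp.norm_apply_le (Matrix.toEuclideanLin T (EuclideanSpace.single j 1)) i).trans h1
  rw [Matrix.toLpLin_apply] at h2
  simp only [PiLp.ofLp_single, Matrix.mulVec_single_one, Matrix.col_apply] at h2
  exact abs_le.1 h2

lemma posDef_of_tendsto {n : ℕ} {A : ℕ → Matrix (Fin n) (Fin n) ℝ}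
    {T : Matrix (Fin n) (Fin n) ℝ} (hA : ∀ k, (A k).PosDef)
    (hT : Filter.Tendsto A Filter.atTop (nhds T)) (hdet : 0 < T.det) : T.PosDef := by
  have hpsd : T.PosSemidef := by
    apply Matrix.PosSemidef.of_dotProduct_mulVec_nonneg
    · have h1 : Filter.Tendsto (fun k => (A k).conjTranspose) Filter.atTop
          (nhds T.conjTranspose) :=
        (continuous_id.matrix_conjTranspose.tendsto T).comp hT
      exact tendsto_nhds_unique (h1.congr fun k => (hA k).isHermitian) hT
    · intro x
      have hc : Continuous fun B : Matrix (Fin n) (Fin n) ℝ => star x ⬝ᵥ (B.mulVec x) :=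
        continuous_const.dotProduct (continuous_id.matrix_mulVec continuous_const)
      exact ge_of_tendsto' ((hc.tendsto T).comp hT)
        fun k => (hA k).posSemidef.dotProduct_mulVec_nonneg x
  rw [hpsd.posDef_iff_isUnit, Matrix.isUnit_iff_isUnit_det]
  exact hdet.ne'.isUnit

lemma le_sSup_inscribedDets_of_forall_lt {n : ℕ} {f : En n → ℝ} (hlc : LogConcaveFn f)
    (hint : Integrable f) {s c : ℝ} (hs : 0 < s) (hc : 0 < c)
    (h : ∀ t, 0 < t → t < s → c < sSup (inscribedDets f t)) :
    c ≤ sSup (inscribedDets f s) := by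
  have hT : ∀ t, 0 < t → t < s → ∃ T : Matrix (Fin n) (Fin n) ℝ, T.PosDef ∧
      Matrix.toEuclideanLin T '' closedBall (0 : En n) 1 ⊆ {x | t ≤ f x} ∧ c < T.det := by
    intro t ht hts
    have hne : (inscribedDets f t).Nonempty := by
      by_contra hne
      have := h t ht hts
      rw [not_nonempty_iff_eq_empty.1 hne, Real.sSup_empty] at this
      linarith
    obtain ⟨_, ⟨T, hT, hsub, rfl⟩, hcT⟩ := exists_lt_of_lt_csSup hne (h t ht hts)
    exact ⟨T, hT, hsub, hcT⟩
  have hs2 : 0 < s / 2 := half_pos hs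
  obtain ⟨R, hR⟩ : ∃ R : ℝ, ∀ q ∈ {x : En n | s / 2 ≤ f x}, ‖q‖ ≤ R := by
    obtain ⟨T, hTp, hsub, -⟩ := hT (s / 2) hs2 (by linarith)
    obtain ⟨r, hr, hball⟩ := exists_ball_subset_image hTp
    exact exists_norm_le_of_convex_of_measure_lt_top (hlc.convex_superlevel hs2)
      (measure_superlevel_lt_top hint hs2) hr (hball.trans hsub)
  obtain ⟨u, -, hu, hulim⟩ := exists_seq_strictMono_tendsto' (show s / 2 < s by linarith)
  choose A hAp hAsub hAdet using fun k => hT (u k) (hs2.trans (hu k).1) (hu k).2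
  have hAmem : ∀ k, A k ∈ Set.pi univ fun _ : Fin n => Set.pi univ fun _ : Fin n => Icc (-R) R :=
    fun k => mem_pi_Icc_of_norm_toEuclideanLin_le fun x hx =>
      hR _ ((hu k).1.le.trans (hAsub k ⟨x, hx, rfl⟩))
  have hcpt : IsCompact
      (Set.pi univ fun _ : Fin n => Set.pi univ fun _ : Fin n => Icc (-R) R) :=
    isCompact_univ_pi fun _ => isCompact_univ_pi fun _ => isCompact_Icc
  obtain ⟨T, -, φ, hφ, hlim⟩ := hcpt.tendsto_subseq hAmem
  replace hlim : Filter.Tendsto (fun k => A (φ k)) Filter.atTop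
    (nhds (T : Matrix (Fin n) (Fin n) ℝ)) := hlim
  change Matrix (Fin n) (Fin n) ℝ at T
  have hdet : c ≤ T.det := by
    have h1 : Filter.Tendsto (fun k => (A (φ k)).det) Filter.atTop (nhds T.det) :=
      (continuous_id.matrix_det.tendsto T).comp hlim
    exact ge_of_tendsto' h1 fun k => (hAdet _).le
  have hdet0 : 0 < T.det := hc.trans_le hdet
  have hTp : T.PosDef := posDef_of_tendsto (fun k => hAp _) hlim hdet0
  refine le_of_forall_lt fun b hb => ?_
  obtain ⟨r, hr0, hr1, hr⟩ := exists_pow_mul_gt (n := n) (hb.trans_le hdet)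
  refine hr.trans_le (le_csSup (bddAbove_inscribedDets hint hs) ?_)
  refine ⟨r • T, hTp.smul hr0, ?_, by simp⟩
  rintro _ ⟨x, hx, rfl⟩
  set z := Matrix.toEuclideanLin (r • T) x with hz
  have hinv : Filter.Tendsto (fun k => (A (φ k))⁻¹) Filter.atTop (nhds T⁻¹) := by
    refine (continuousAt_matrix_inv T ?_).tendsto.comp hlim
    rw [Ring.inverse_eq_inv']
    exact continuousAt_inv₀ hdet0.ne'
  have hy : Filter.Tendsto (fun k => Matrix.toEuclideanLin (A (φ k))⁻¹ z) Filter.atTop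
      (nhds (r • x)) := by
    have h1 : Continuous fun B : Matrix (Fin n) (Fin n) ℝ => Matrix.toEuclideanLin B z :=
      (PiLp.continuous_toLp 2 _).comp (continuous_id.matrix_mulVec continuous_const)
    have h2 : Matrix.toEuclideanLin T⁻¹ z = r • x := by
      have hu : IsUnit T.det := hdet0.ne'.isUnit
      rw [hz, map_smul, LinearMap.smul_apply, map_smul]
      simp [Matrix.toLpLin_apply, Matrix.mulVec_mulVec, Matrix.nonsing_inv_mul T hu]
    rw [← h2]
    exact (h1.tendsto _).comp hinv
  have hnorm : ‖r • x‖ < 1 := by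
    rw [norm_smul, Real.norm_of_nonneg hr0.le]
    nlinarith [mem_closedBall_zero_iff.1 hx, norm_nonneg x]
  have hev : ∀ᶠ k in Filter.atTop, u (φ k) ≤ f z := by
    filter_upwards [hy.norm.eventually_lt_const hnorm] with k hk
    have := hAsub (φ k) ⟨_, mem_closedBall_zero_iff.2 hk.le, rfl⟩
    rwa [toEuclideanLin_inv_apply (hAp _)] at this
  exact le_of_tendsto (hulim.comp hφ.tendsto_atTop) hev

lemma continuousOn_sSup_inscribedDets {n : ℕ} {f : En n → ℝ} (hlc : LogConcaveFn f)
    (hint : Integrable f) :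
    ContinuousOn (fun s => sSup (inscribedDets f s)) (Ioc 0 (sSup (range f))) := by
  rintro s ⟨hs, hsM⟩
  refine tendsto_order.2 ⟨fun c hc => ?_, fun c hc => ?_⟩
  · rcases hsM.lt_or_eq with hlt | heq
    · obtain ⟨t, hst, ht⟩ := exists_gt_lt_sSup_inscribedDets hlc hint hs hlt hc
      filter_upwards [self_mem_nhdsWithin, nhdsWithin_le_nhds (gt_mem_nhds hst)] with w hw hwt
      exact ht.trans_le (sSup_inscribedDets_antitone hint hw.1 hwt.le)
    · filter_upwards [self_mem_nhdsWithin] with w hw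
      exact hc.trans_le (sSup_inscribedDets_antitone hint hw.1 (heq ▸ hw.2))
  · obtain ⟨b, hb, hbc⟩ := exists_between hc
    obtain ⟨t, ht0, hts, ht⟩ : ∃ t, 0 < t ∧ t < s ∧ sSup (inscribedDets f t) ≤ b := by
      by_contra! hcon
      have := le_sSup_inscribedDets_of_forall_lt hlc hint hs
        ((sSup_inscribedDets_nonneg f s).trans_lt hb) hcon
      linarith
    filter_upwards [nhdsWithin_le_nhds (lt_mem_nhds hts)] with w hw
    exact ((sSup_inscribedDets_antitone hint ht0 hw.le).trans ht).trans_lt hbc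

/-- the map `s ↦ ξ_f(s)` is continuous on `(0, ‖f‖_∞]`. -/
theorem xi_continuousOn {n : ℕ}
    (f : En n → ℝ)
    (hlc : LogConcaveFn f)
    (hint : Integrable f)
    (hnd : (interior {x | 0 < f x}).Nonempty) :
    ContinuousOn (xiFn f) (Set.Ioc 0 (sSup (Set.range f))) :=
  continuousOn_id.mul (continuousOn_sSup_inscribedDets hlc hint)
end
end

section
/- Let (f_m) and f be nondegenerate integrable log-concave functions on ℝⁿ such that f_m → f pointwise. Then ‖f_m‖_∞ → ‖f‖_∞ as m → ∞. -/
open MeasureTheory Metric Set Filter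

noncomputable section

open scoped Topology

namespace LogConcaveFn

variable {n : ℕ} {f : En n → ℝ}

lemma convex_superlevel_s10 (hf : LogConcaveFn f) {c : ℝ} (hc : 0 < c) :
    Convex ℝ {x | c ≤ f x} := by
  intro x hx y hy a b ha hb hab
  obtain rfl : b = 1 - a := by linarith
  simp only [mem_ofPred_eq] at hx hy ⊢
  calc c = c ^ a * c ^ (1 - a) := by rw [← Real.rpow_add hc]; simp
    _ ≤ f x ^ a * f y ^ (1 - a) := by
        have := Real.rpow_nonneg (hf.1 x) a
        gcongr
    _ ≤ f (a • x + (1 - a) • y) := hf.2 x y a ha (by linarith)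

/-- A lower bound on a ball and a lower bound at a point `z` propagate to the balls of the cone
over the first ball with apex `z`. -/
lemma le_on_cone (hf : LogConcaveFn f) {c r S t : ℝ} {x₀ z : En n} (hc : 0 < c)
    (hball : ∀ x ∈ ball x₀ r, c ≤ f x) (hS : 0 < S) (hz : S ≤ f z) (ht : 0 < t) (ht1 : t ≤ 1)
    {w : En n} (hw : dist w ((1 - t) • z + t • x₀) < t * r) :
    S ^ (1 - t) * c ^ t ≤ f w := by
  set y : En n := x₀ + t⁻¹ • (w - ((1 - t) • z + t • x₀)) with hy
  have hyw : t • y + (1 - t) • z = w := by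
    rw [hy, smul_add, smul_smul, mul_inv_cancel₀ ht.ne']
    module
  have hyb : y ∈ ball x₀ r := by
    rw [mem_ball, dist_eq_norm, hy, add_sub_cancel_left, norm_smul, norm_inv, Real.norm_eq_abs,
      abs_of_pos ht, ← dist_eq_norm, inv_mul_lt_iff₀ ht]
    exact hw
  calc S ^ (1 - t) * c ^ t = c ^ t * S ^ (1 - t) := mul_comm _ _
    _ ≤ f y ^ t * f z ^ (1 - t) := by
        have := hball y hyb
        have := Real.rpow_nonneg (hf.1 y) t
        have : 0 ≤ 1 - t := by linarith
        gcongr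
    _ ≤ f w := hyw ▸ hf.2 y z t ht.le ht1

lemma mul_volume_ball_le_setIntegral (hf : LogConcaveFn f) (hint : Integrable f) {a ρ : ℝ}
    {w : En n} {s : Set (En n)} (hs : ball w ρ ⊆ s) (ha : ∀ x ∈ ball w ρ, a ≤ f x) :
    a * volume.real (ball (0 : En n) ρ) ≤ ∫ x in s, f x := by
  calc a * volume.real (ball (0 : En n) ρ) = ∫ _ in ball w ρ, a := by
        rw [setIntegral_const, smul_eq_mul, mul_comm, Measure.addHaar_real_ball_center volume w]
    _ ≤ ∫ x in ball w ρ, f x :=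
        setIntegral_mono_on (integrableOn_const measure_ball_lt_top.ne) hint.integrableOn
          measurableSet_ball ha
    _ ≤ ∫ x in s, f x :=
        setIntegral_mono_set hint.integrableOn (Eventually.of_forall hf.1) hs.eventuallyLE

lemma bddAbove_range (hf : LogConcaveFn f) (hint : Integrable f) {c r : ℝ} {x₀ : En n}
    (hc : 0 < c) (hr : 0 < r) (hball : ∀ x ∈ ball x₀ r, c ≤ f x) : BddAbove (range f) := by
  set V := volume.real (ball (0 : En n) (1 / 2 * r))
  have hVpos : 0 < V :=
    ENNReal.toReal_pos (measure_ball_pos _ _ (by positivity)).ne' measure_ball_lt_top.ne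
  refine ⟨((∫ x, f x) / V) ^ 2 / c, ?_⟩
  rintro _ ⟨z, rfl⟩
  rcases (hf.1 z).eq_or_lt with h0 | hpos
  · rw [← h0]; positivity
  have key : (f z ^ (1 - 1 / 2 : ℝ) * c ^ (1 / 2 : ℝ)) * V ≤ ∫ x in univ, f x :=
    hf.mul_volume_ball_le_setIntegral hint (w := (1 - 1 / 2 : ℝ) • z + (1 / 2 : ℝ) • x₀)
      (subset_univ _) fun w hw =>
        hf.le_on_cone hc hball hpos le_rfl (by norm_num) (by norm_num) hw
  rw [setIntegral_univ, ← le_div_iff₀ hVpos] at key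
  rw [le_div_iff₀ hc]
  have hsq := pow_le_pow_left₀ (by positivity) key 2
  have e : (1 - 1 / 2 : ℝ) = 1 / 2 := by norm_num
  rwa [mul_pow, e, ← Real.sqrt_eq_rpow, ← Real.sqrt_eq_rpow, Real.sq_sqrt hpos.le,
    Real.sq_sqrt hc.le] at hsq

lemma exists_superlevel_subset_ball (hf : LogConcaveFn f) (hint : Integrable f) {c r : ℝ}
    {x₀ : En n} (hc : 0 < c) (hr : 0 < r) (hball : ∀ x ∈ ball x₀ r, c ≤ f x) :
    ∃ R > 0, ∀ z, c ≤ f z → dist z x₀ < R := by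
  have hV : 0 < c * volume.real (ball (0 : En n) (1 / 2 * r)) :=
    mul_pos hc <|
      ENNReal.toReal_pos (measure_ball_pos _ _ (by positivity)).ne' measure_ball_lt_top.ne
  have hlim := tendsto_setIntegral_of_antitone (μ := volume) (f := f)
    (s := fun k : ℕ => (closedBall x₀ (k : ℝ))ᶜ) (fun k => measurableSet_closedBall.compl)
    (fun i j hij => compl_subset_compl.2 (closedBall_subset_closedBall (by exact_mod_cast hij)))
    ⟨0, hint.integrableOn⟩
  rw [← compl_iUnion, iUnion_closedBall_nat, compl_univ, Measure.restrict_empty,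
    integral_zero_measure] at hlim
  obtain ⟨k, hk⟩ := (hlim.eventually_lt_const hV).exists
  refine ⟨2 * (k + r), by positivity, fun z hz => ?_⟩
  by_contra! hfar
  refine hk.not_ge (hf.mul_volume_ball_le_setIntegral hint
    (w := (1 - 1 / 2 : ℝ) • z + (1 / 2 : ℝ) • x₀) (fun w hw => ?_) fun w hw => ?_)
  · rw [mem_compl_iff, mem_closedBall, not_le]
    have hd : dist ((1 - 1 / 2 : ℝ) • z + (1 / 2 : ℝ) • x₀) x₀ = 1 / 2 * dist z x₀ := by
      rw [dist_eq_norm, dist_eq_norm, show (1 - 1 / 2 : ℝ) • z + (1 / 2 : ℝ) • x₀ - x₀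
        = (1 / 2 : ℝ) • (z - x₀) by module, norm_smul]
      norm_num
    have := dist_triangle_left ((1 - 1 / 2 : ℝ) • z + (1 / 2 : ℝ) • x₀) x₀ w
    rw [mem_ball] at hw
    linarith
  · have := hf.le_on_cone hc hball hc hz (by norm_num) (by norm_num) hw
    rwa [← Real.rpow_add hc, sub_add_cancel, Real.rpow_one] at this

end LogConcaveFn

section Convergence

variable {n : ℕ} {fm : ℕ → En n → ℝ} {f : En n → ℝ}

lemma exists_ball_eventually_le (hlcm : ∀ m, LogConcaveFn (fm m)) (hlc : LogConcaveFn f)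
    (hnd : (interior {x | 0 < f x}).Nonempty)
    (hptw : ∀ x, Tendsto (fun m => fm m x) atTop (𝓝 (f x))) :
    ∃ x₀ : En n, ∃ c > 0, ∃ r > 0, (∀ x ∈ ball x₀ r, c ≤ f x) ∧
      ∀ᶠ m in atTop, ∀ x ∈ ball x₀ r, c ≤ fm m x := by
  obtain ⟨x₀, hx₀⟩ := hnd
  obtain ⟨b, hb, hbs⟩ :=
    exists_mem_interior_convexHull_affineBasis (mem_interior_iff_mem_nhds.1 hx₀)
  obtain ⟨r, hr, hball⟩ := Metric.isOpen_iff.1 isOpen_interior x₀ hb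
  obtain ⟨i, hi⟩ := Finite.exists_min (fun i => f (b i))
  have hpos : 0 < f (b i) := hbs (subset_convexHull ℝ _ (mem_range_self i))
  have extend : ∀ g : En n → ℝ, LogConcaveFn g → (∀ j, f (b i) / 2 ≤ g (b j)) →
      ∀ x ∈ ball x₀ r, f (b i) / 2 ≤ g x := fun g hg h x hx =>
    convexHull_min (s := range b) (t := {x | f (b i) / 2 ≤ g x}) (range_subset_iff.2 h)
      (hg.convex_superlevel_s10 (half_pos hpos)) (interior_subset (hball hx))
  refine ⟨x₀, f (b i) / 2, half_pos hpos, r, hr,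
    extend f hlc fun j => (half_le_self hpos.le).trans (hi j), ?_⟩
  have hev : ∀ᶠ m in atTop, ∀ j, f (b i) / 2 ≤ fm m (b j) :=
    eventually_all.2 fun j =>
      (hptw (b j)).eventually_const_le ((half_lt_self hpos).trans_le (hi j))
  filter_upwards [hev] with m hm using extend _ (hlcm m) hm

lemma exists_eventually_superlevel_subset_ball (hlcm : ∀ m, LogConcaveFn (fm m))
    (hlc : LogConcaveFn f) (hint : Integrable f)
    (hptw : ∀ x, Tendsto (fun m => fm m x) atTop (𝓝 (f x))) {c r : ℝ} {x₀ : En n}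
    (hc : 0 < c) (hr : 0 < r) (hball : ∀ x ∈ ball x₀ r, c ≤ f x)
    (hballm : ∀ᶠ m in atTop, ∀ x ∈ ball x₀ r, c ≤ fm m x) :
    ∃ R, ∀ᶠ m in atTop, ∀ z, c ≤ fm m z → dist z x₀ < R := by
  obtain ⟨R, hR, hRf⟩ := hlc.exists_superlevel_subset_ball hint hc hr hball
  obtain ⟨T, hTs, hT, hcov⟩ :=
    (isCompact_sphere x₀ R).finite_cover_balls (e := 1 / 2 * r) (by positivity)
  have hev : ∀ᶠ m in atTop, ∀ w ∈ T, fm m w < c :=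
    (eventually_all_finite hT).2 fun w hw => (hptw w).eventually_lt_const <| by
      by_contra! h
      exact (hRf w h).ne (hTs hw)
  refine ⟨2 * R, ?_⟩
  filter_upwards [hev, hballm] with m hm hbm z hz
  by_contra! hfar
  have hD : 0 < dist z x₀ := by linarith
  set t := 1 - R / dist z x₀ with ht
  have hq : R / dist z x₀ ≤ 1 / 2 := by rw [div_le_iff₀ hD]; linarith
  have hq0 : 0 < R / dist z x₀ := by positivity
  have hsph : (1 - t) • z + t • x₀ ∈ sphere x₀ R := by
    rw [mem_sphere, dist_eq_norm, show (1 - t) • z + t • x₀ - x₀ = (1 - t) • (z - x₀) by module,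
      norm_smul, ht, sub_sub_cancel, ← dist_eq_norm z, Real.norm_of_nonneg hq0.le,
      div_mul_cancel₀ _ hD.ne']
  obtain ⟨w, hwT, hw⟩ := mem_iUnion₂.1 (hcov hsph)
  refine (hm w hwT).not_ge ?_
  have hwt : dist w ((1 - t) • z + t • x₀) < t * r := by
    rw [dist_comm]
    refine (mem_ball.1 hw).trans_le ?_
    gcongr
    linarith
  have := (hlcm m).le_on_cone hc hbm hc hz (by linarith) (by linarith) hwt
  rwa [← Real.rpow_add hc, sub_add_cancel, Real.rpow_one] at this

lemma eventually_forall_lt_of_sSup_lt (hlcm : ∀ m, LogConcaveFn (fm m))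
    (hlc : LogConcaveFn f) (hint : Integrable f) (hnd : (interior {x | 0 < f x}).Nonempty)
    (hptw : ∀ x, Tendsto (fun m => fm m x) atTop (𝓝 (f x))) {S : ℝ}
    (hS : sSup (range f) < S) : ∀ᶠ m in atTop, ∀ z, fm m z < S := by
  obtain ⟨x₀, c, hc, r, hr, hball, hballm⟩ := exists_ball_eventually_le hlcm hlc hnd hptw
  have hfS : ∀ x, f x ≤ sSup (range f) := fun x =>
    le_csSup (hlc.bddAbove_range hint hc hr hball) (mem_range_self x)
  have hcS : c < S := ((hball x₀ (mem_ball_self hr)).trans (hfS x₀)).trans_lt hS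
  have hS0 : 0 < S := hc.trans hcS
  obtain ⟨R, hR⟩ :=
    exists_eventually_superlevel_subset_ball hlcm hlc hint hptw hc hr hball hballm
  have hcont : Tendsto (fun t : ℝ => S ^ (1 - t) * c ^ t) (𝓝[>] 0) (𝓝 S) := by
    have : ContinuousAt (fun t : ℝ => S ^ (1 - t) * c ^ t) 0 :=
      (continuousAt_const.rpow (by fun_prop) (Or.inl hS0.ne')).mul
        (continuousAt_const.rpow continuousAt_id (Or.inl hc.ne'))
    simpa using this.tendsto.mono_left nhdsWithin_le_nhds
  obtain ⟨t, htS, ht0, ht1⟩ :=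
    ((hcont.eventually_const_lt hS).and (Ioc_mem_nhdsGT zero_lt_one)).exists
  obtain ⟨T, -, hT, hcov⟩ :=
    (isCompact_closedBall x₀ R).finite_cover_balls (e := t * r) (by positivity)
  have hev : ∀ᶠ m in atTop, ∀ z ∈ T, fm m ((1 - t) • z + t • x₀) < S ^ (1 - t) * c ^ t :=
    (eventually_all_finite hT).2 fun z _ =>
      (hptw _).eventually_lt_const ((hfS _).trans_lt htS)
  filter_upwards [hev, hballm, hR] with m hm hbm hRm z
  by_contra! hz
  obtain ⟨y, hyT, hy⟩ := mem_iUnion₂.1 (hcov (hRm z (hcS.le.trans hz)).le)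
  refine (hm y hyT).not_ge ((hlcm m).le_on_cone hc hbm hS0 hz ht0 ht1 ?_)
  rw [dist_add_right, dist_smul₀, Real.norm_of_nonneg (by linarith), dist_comm]
  refine (mul_le_of_le_one_left dist_nonneg (by linarith)).trans_lt (mem_ball.1 hy)

end Convergence

/-- if nondegenerate integrable log-concave functions `f_m`
converge pointwise to `f`, then `‖f_m‖_∞ → ‖f‖_∞`. -/
theorem sup_norm_convergence {n : ℕ}
    (fm : ℕ → (En n → ℝ)) (f : En n → ℝ)
    (hlcm : ∀ m, LogConcaveFn (fm m))
    (hintm : ∀ m, Integrable (fm m))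
    (hndm : ∀ m, (interior {x | 0 < fm m x}).Nonempty)
    (hlc : LogConcaveFn f)
    (hint : Integrable f)
    (hnd : (interior {x | 0 < f x}).Nonempty)
    (hptw : ∀ x, Tendsto (fun m => fm m x) atTop (nhds (f x))) :
    Tendsto (fun m => sSup (Set.range (fm m))) atTop (nhds (sSup (Set.range f))) := by
  refine tendsto_order.2 ⟨fun a ha => ?_, fun b hb => ?_⟩
  · obtain ⟨_, ⟨x, rfl⟩, hx⟩ := exists_lt_of_lt_csSup (range_nonempty f) ha
    filter_upwards [(hptw x).eventually_const_lt hx,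
      eventually_forall_lt_of_sSup_lt hlcm hlc hint hnd hptw (lt_add_one _)] with m hm hbdd
    exact hm.trans_le (le_csSup ⟨_, forall_mem_range.2 fun z => (hbdd z).le⟩ (mem_range_self x))
  · obtain ⟨S, hS, hSb⟩ := exists_between hb
    filter_upwards [eventually_forall_lt_of_sSup_lt hlcm hlc hint hnd hptw hS] with m hm
    exact (csSup_le (range_nonempty _) (forall_mem_range.2 fun z => (hm z).le)).trans_lt hSb
end
end
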